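/- Let a < b be real numbers and let f, g : ℝ → ℝ be continuous on [a, b]. Suppose that for every function h : ℝ → ℝ that is continuous and strictly decreasing on [a, b], the intersection sets coincide: {x ∈ [a, b] : h(x) = f(x)} = {x ∈ [a, b] : h(x) = g(x)}. Then f(x) = g(x) for all x ∈ [a, b]. -/

import Mathlib

open Set

/-- Let `a < b` and `f, g : ℝ → ℝ` be continuous on `[a, b]`. If for every
function `h` continuous and strictly decreasing on `[a, b]` the intersection
sets `{x ∈ [a,b] | h x = f x}` and `{x ∈ [a,b] | h x = g x}` coincide, then
`f = g` on `[a, b]`. -/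
theorem stmt14 (a b : ℝ) (hab : a < b) (f g : ℝ → ℝ)
    (hf : ContinuousOn f (Set.Icc a b)) (hg : ContinuousOn g (Set.Icc a b))
    (h : ∀ h' : ℝ → ℝ, ContinuousOn h' (Set.Icc a b) → StrictAntiOn h' (Set.Icc a b) →
      {x ∈ Set.Icc a b | h' x = f x} = {x ∈ Set.Icc a b | h' x = g x}) :
    ∀ x ∈ Set.Icc a b, f x = g x := by
  intro x hx
  have key := h (fun t => f x + (x - t)) (by fun_prop)
    (fun s _ t _ hst => by simpa using hst)
  have hmem : x ∈ {t ∈ Set.Icc a b | f x + (x - t) = f t} := ⟨hx, by simp⟩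
  rw [key] at hmem
  simpa using hmem.2
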